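/- arXiv:2008.10173 — 3 statements merged into one kernel-verified Lean document; each statement's English description precedes it below -/
import Mathlib

section
/- Let y : [0,∞) → [0,∞) be a non-negative differentiable function, let a₁ > 0, a₂ ∈ ℝ, and let a₃ : [0,∞) → [0,∞) be continuous. Suppose that y(t) − y(r) ≤ −a₁ ∫_r^t y(s) ds + a₂ ∫_r^t √(y(s)) ds + ∫_r^t a₃(s) ds for all t > r ≥ 0. Then for every t ≥ 0, y(t) ≤ max{ y(0), ( a₂/(2a₁) + √( (sup_{0≤s≤t} a₃(s))/a₁ + a₂²/(4a₁²) ) )² }. In particular, if a₂ = 0 then y(t) ≤ max{ y(0), (sup_{0≤s≤t} a₃(s))/a₁ }. -/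
open MeasureTheory

/-- If a non-negative differentiable function `y` on `[0,∞)` satisfies
`y(t) − y(r) ≤ −a₁ ∫_r^t y + a₂ ∫_r^t √y + ∫_r^t a₃` for all `t > r ≥ 0`, with `a₁ > 0` and
`a₃` continuous and non-negative, then
`y(t) ≤ max { y(0), (a₂/(2a₁) + √((sup_{[0,t]} a₃)/a₁ + a₂²/(4a₁²)))² }`, and in particular
`y(t) ≤ max { y(0), (sup_{[0,t]} a₃)/a₁ }` when `a₂ = 0`. -/
theorem stmt0 (y a₃ : ℝ → ℝ) (a₁ a₂ : ℝ)
    (hy_nonneg : ∀ t, 0 ≤ t → 0 ≤ y t)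
    (hy_diff : DifferentiableOn ℝ y (Set.Ici 0))
    (ha₁ : 0 < a₁)
    (ha₃_nonneg : ∀ s, 0 ≤ s → 0 ≤ a₃ s)
    (ha₃_cont : ContinuousOn a₃ (Set.Ici 0))
    (hineq : ∀ r t : ℝ, 0 ≤ r → r < t →
      y t - y r ≤ (-a₁) * (∫ s in r..t, y s) + a₂ * (∫ s in r..t, Real.sqrt (y s))
        + ∫ s in r..t, a₃ s) :
    (∀ t, 0 ≤ t →
      y t ≤ max (y 0)
        ((a₂ / (2 * a₁)
          + Real.sqrt ((⨆ s : Set.Icc (0:ℝ) t, a₃ s) / a₁ + a₂ ^ 2 / (4 * a₁ ^ 2))) ^ 2)) ∧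
    (a₂ = 0 → ∀ t, 0 ≤ t →
      y t ≤ max (y 0) ((⨆ s : Set.Icc (0:ℝ) t, a₃ s) / a₁)) := by
  have hyc : ContinuousOn y (Set.Ici 0) := hy_diff.continuousOn
  have hS : ∀ t, 0 ≤ t → ∀ s ∈ Set.Icc (0:ℝ) t, a₃ s ≤ ⨆ s : Set.Icc (0:ℝ) t, a₃ s := by
    intro t ht s hs
    have hb : BddAbove (a₃ '' Set.Icc 0 t) :=
      (isCompact_Icc.image_of_continuousOn (ha₃_cont.mono Set.Icc_subset_Ici_self)).bddAbove
    have hb2 : BddAbove (Set.range fun s : Set.Icc (0:ℝ) t => a₃ s) := by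
      rwa [Set.image_eq_range] at hb
    exact le_ciSup hb2 ⟨s, hs⟩
  have hmain : ∀ t, 0 ≤ t →
      y t ≤ max (y 0)
        ((a₂ / (2 * a₁)
          + Real.sqrt ((⨆ s : Set.Icc (0:ℝ) t, a₃ s) / a₁ + a₂ ^ 2 / (4 * a₁ ^ 2))) ^ 2) := by
    intro t ht
    have hSt := hS t ht
    set S := ⨆ s : Set.Icc (0:ℝ) t, a₃ s with hSdef
    have hS0 : 0 ≤ S := (ha₃_nonneg 0 le_rfl).trans (hSt 0 ⟨le_rfl, ht⟩)
    obtain ⟨b, hb⟩ : ∃ b, b = a₂ / (2 * a₁) := ⟨_, rfl⟩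
    have hb2 : a₂ ^ 2 / (4 * a₁ ^ 2) = b ^ 2 := by rw [hb, div_pow]; ring
    have hab : a₂ = 2 * a₁ * b := by rw [hb]; field_simp
    rw [hb2, ← hb]
    obtain ⟨D, hD⟩ : ∃ D, D = S / a₁ + b ^ 2 := ⟨_, rfl⟩
    rw [← hD]
    have hSa : 0 ≤ S / a₁ := by positivity
    have hSD : S = a₁ * (D - b ^ 2) := by rw [hD]; field_simp; ring
    have hD0 : 0 ≤ D := by rw [hD]; positivity
    have hc0 : 0 ≤ b + √D := by
      have : |b| ≤ √D := Real.abs_le_sqrt (by linarith)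
      linarith [neg_abs_le b]
    by_contra hcon
    rw [not_le] at hcon
    set M := max (y 0) ((b + √D) ^ 2) with hM
    have hycI : ContinuousOn y (Set.Icc 0 t) := hyc.mono Set.Icc_subset_Ici_self
    have hcomp : IsCompact (Set.Icc 0 t ∩ y ⁻¹' Set.Iic M) :=
      isCompact_Icc.of_isClosed_subset
        (hycI.preimage_isClosed_of_isClosed isClosed_Icc isClosed_Iic) Set.inter_subset_left
    obtain ⟨r, ⟨hr, hrM⟩, hmax⟩ := hcomp.exists_isGreatest
      ⟨0, ⟨le_rfl, ht⟩, (le_max_left (y 0) _ : y 0 ≤ M)⟩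
    have hrM' : y r ≤ M := hrM
    have hrt : r < t := lt_of_le_of_ne hr.2 (by rintro rfl; linarith)
    have hgt : ∀ s ∈ Set.Ioc r t, M < y s := by
      intro s hs
      by_contra h
      have := hmax ⟨⟨hr.1.trans hs.1.le, hs.2⟩, not_lt.1 h⟩
      linarith [hs.1]
    have hsub : Set.uIcc r t ⊆ Set.Ici 0 := by
      rw [Set.uIcc_of_le hrt.le]; intro s hs; exact hr.1.trans hs.1
    have i1 : IntervalIntegrable y volume r t := (hyc.mono hsub).intervalIntegrable
    have i2 : IntervalIntegrable (fun s => √(y s)) volume r t :=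
      (hyc.mono hsub).sqrt.intervalIntegrable
    have i3 : IntervalIntegrable a₃ volume r t := (ha₃_cont.mono hsub).intervalIntegrable
    have h := hineq r t hr.1 hrt
    rw [← intervalIntegral.integral_const_mul, ← intervalIntegral.integral_const_mul,
      ← intervalIntegral.integral_add (i1.const_mul _) (i2.const_mul _),
      ← intervalIntegral.integral_add ((i1.const_mul _).add (i2.const_mul _)) i3] at h
    have hle : ∫ s in r..t, (-a₁ * y s + a₂ * √(y s) + a₃ s) ≤ ∫ s in r..t, (0:ℝ) := by
      refine intervalIntegral.integral_mono_on_of_le_Ioo hrt.le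
        (((i1.const_mul _).add (i2.const_mul _)).add i3) (by simp) ?_
      intro s hs
      have hys := hgt s ⟨hs.1, hs.2.le⟩
      have hs0 : 0 ≤ s := hr.1.trans hs.1.le
      have h3 := hSt s ⟨hs0, hs.2.le⟩
      have hx : b + √D ≤ √(y s) := Real.le_sqrt_of_sq_le ((le_max_right _ _).trans hys.le)
      have hsq := Real.sq_sqrt (hy_nonneg s hs0)
      have hDsq := Real.sq_sqrt hD0
      have hD' := Real.sqrt_nonneg D
      have hk : D ≤ (√(y s) - b) ^ 2 := by nlinarith
      have := mul_le_mul_of_nonneg_left hk ha₁.le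
      rw [hab]
      nlinarith
    rw [intervalIntegral.integral_zero] at hle
    linarith
  refine ⟨hmain, ?_⟩
  intro h0 t ht
  have h := hmain t ht
  have hS0 := (ha₃_nonneg 0 le_rfl).trans (hS t ht 0 ⟨le_rfl, ht⟩)
  have hSa := div_nonneg hS0 ha₁.le
  simpa [h0, Real.sq_sqrt hSa] using h
end

section
/- Let n ≥ 1 and z = (z_{ij}) ∈ [0,1]^{n×n} with z_{ij} = z_{ji}. Let g₁,…,g_n : [0,∞) → ℝ^d be continuous functions, and let Y, Ỹ : [0,∞) → (ℝ^d)^n be continuous functions satisfying, for every i ∈ {1,…,n} and every t ≥ 0, Y_i(t) = Y_i(0) + ∫₀ᵗ ( f(Y_i(s)) + n⁻¹ ∑_{j=1}^n z_{ij} b(Y_i(s), Y_j(s)) ) ds + g_i(t), and the same equation for Ỹ with the same forcing functions g_i. Then ∑_{i=1}^n |Y_i(t) − Ỹ_i(t)|² ≤ e^{−2κt} ∑_{i=1}^n |Y_i(0) − Ỹ_i(0)|² for all t ≥ 0. -/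
open MeasureTheory Set
open scoped RealInnerProductSpace

noncomputable section

/-- `d`-dimensional Euclidean space. -/
abbrev Ed (d : ℕ) := EuclideanSpace ℝ (Fin d)

/-- Pathwise contraction for two solutions of the `n`-particle
integral equation driven by the same forcing functions `g i`:
`∑ᵢ |Yᵢ(t) − Ỹᵢ(t)|² ≤ e^{−2κt} ∑ᵢ |Yᵢ(0) − Ỹᵢ(0)|²`, where `κ = c₀ − 2K_b`. -/
theorem stmt6 (d : ℕ) (hd : 1 ≤ d)
    (f : Ed d → Ed d) (b : Ed d → Ed d → Ed d) (Kf Kb c₀ : ℝ)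
    (hf : ∀ x₁ x₂, ‖f x₁ - f x₂‖ ≤ Kf * ‖x₁ - x₂‖)
    (hb : ∀ x₁ x₂ y₁ y₂, ‖b x₁ y₁ - b x₂ y₂‖ ≤ Kb * (‖x₁ - x₂‖ + ‖y₁ - y₂‖))
    (hdiss : ∀ x₁ x₂ : Ed d, ⟪x₁ - x₂, f x₁ - f x₂⟫ ≤ -c₀ * ‖x₁ - x₂‖ ^ 2)
    (hc₀ : 0 < c₀) (hκ : 0 < c₀ - 2 * Kb)
    (n : ℕ) (hn : 1 ≤ n) (z : Fin n → Fin n → ℝ)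
    (hz : ∀ i j, z i j ∈ Set.Icc (0:ℝ) 1) (hzsym : ∀ i j, z i j = z j i)
    (g : Fin n → ℝ → Ed d) (hg : ∀ i, ContinuousOn (g i) (Set.Ici 0))
    (Y Z : ℝ → Fin n → Ed d)
    (hYc : ∀ i, ContinuousOn (fun t => Y t i) (Set.Ici 0))
    (hZc : ∀ i, ContinuousOn (fun t => Z t i) (Set.Ici 0))
    (hYeq : ∀ (i : Fin n) (t : ℝ), 0 ≤ t →
      Y t i = Y 0 i
        + (∫ s in (0:ℝ)..t,
            (f (Y s i) + (n:ℝ)⁻¹ • ∑ j, z i j • b (Y s i) (Y s j)))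
        + g i t)
    (hZeq : ∀ (i : Fin n) (t : ℝ), 0 ≤ t →
      Z t i = Z 0 i
        + (∫ s in (0:ℝ)..t,
            (f (Z s i) + (n:ℝ)⁻¹ • ∑ j, z i j • b (Z s i) (Z s j)))
        + g i t) :
    ∀ t : ℝ, 0 ≤ t →
      ∑ i, ‖Y t i - Z t i‖ ^ 2
        ≤ Real.exp (-2 * (c₀ - 2 * Kb) * t) * ∑ i, ‖Y 0 i - Z 0 i‖ ^ 2 := by
  have hKb : 0 ≤ Kb := by
    have h := hb (EuclideanSpace.single (⟨0, hd⟩ : Fin d) (1:ℝ)) 0 0 0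
    have h1 : ‖(EuclideanSpace.single (⟨0, hd⟩ : Fin d) (1:ℝ)) - 0‖ = 1 := by simp
    rw [h1] at h
    have h2 := (norm_nonneg _).trans h
    simpa using h2
  have hfc : Continuous f :=
    (LipschitzWith.of_dist_le' (K := Kf) (fun x y => by
      simpa [dist_eq_norm] using hf x y)).continuous
  have hbc : Continuous (fun p : Ed d × Ed d => b p.1 p.2) :=
    (LipschitzWith.of_dist_le' (K := Kb * 2) (fun x y => by
      have h := hb x.1 y.1 x.2 y.2
      rw [dist_eq_norm, dist_eq_norm]
      refine h.trans ?_
      have h1 : ‖x.1 - y.1‖ ≤ ‖x - y‖ := norm_fst_le (x - y)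
      have h2 : ‖x.2 - y.2‖ ≤ ‖x - y‖ := norm_snd_le (x - y)
      nlinarith)).continuous
  have hmax : Continuous (fun t : ℝ => max t 0) := by fun_prop
  have ext : ∀ (X : ℝ → Fin n → Ed d), (∀ i, ContinuousOn (fun t => X t i) (Set.Ici 0)) →
      ∀ i, Continuous (fun t => X (max t 0) i) := fun X hX i =>
    (hX i).comp_continuous hmax (fun t => le_max_right t 0)
  let F : (ℝ → Fin n → Ed d) → Fin n → ℝ → Ed d := fun X i s =>
    f (X s i) + (n:ℝ)⁻¹ • ∑ j, z i j • b (X s i) (X s j)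
  have hFc : ∀ (X : ℝ → Fin n → Ed d), (∀ i, ContinuousOn (fun t => X t i) (Set.Ici 0)) →
      ∀ i, Continuous (fun t => F X i (max t 0)) := by
    intro X hX i
    have h1 := ext X hX
    refine (hfc.comp (h1 i)).add (Continuous.fun_const_smul ?_ _)
    refine continuous_finsetSum _ (fun j _ => Continuous.fun_const_smul ?_ _)
    exact hbc.comp ((h1 i).prodMk (h1 j))
  have hint : ∀ (X : ℝ → Fin n → Ed d) i (t : ℝ), 0 ≤ t →
      (∫ s in (0:ℝ)..t, F X i s) = ∫ s in (0:ℝ)..t, F X i (max s 0) := by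
    intro X i t ht
    refine intervalIntegral.integral_congr (fun s hs => ?_)
    rw [Set.uIcc_of_le ht] at hs
    simp only [max_eq_left hs.1]
  have hD : ∀ i (t : ℝ), 0 < t →
      HasDerivAt (fun t => Y t i - Z t i) (F Y i t - F Z i t) t := by
    intro i t ht
    have h1 := (intervalIntegral.integral_hasDerivAt_right
      ((hFc Y hYc i).intervalIntegrable 0 t)
      ((hFc Y hYc i).stronglyMeasurableAtFilter _ _) (hFc Y hYc i).continuousAt)
    have h2 := (intervalIntegral.integral_hasDerivAt_right
      ((hFc Z hZc i).intervalIntegrable 0 t)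
      ((hFc Z hZc i).stronglyMeasurableAtFilter _ _) (hFc Z hZc i).continuousAt)
    have h3 := (h1.sub h2).const_add (Y 0 i - Z 0 i)
    rw [max_eq_left ht.le] at h3
    refine h3.congr_of_eventuallyEq ?_
    filter_upwards [lt_mem_nhds ht] with s hs
    have e1 := hYeq i s hs.le
    have e2 := hZeq i s hs.le
    have e3 := hint Y i s hs.le
    have e4 := hint Z i s hs.le
    simp only [F] at e3 e4
    rw [e1, e2, e3, e4]
    simp only [F, Pi.sub_apply]
    abel
  have key : ∀ t : ℝ, ∑ i, ⟪Y t i - Z t i, F Y i t - F Z i t⟫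
      ≤ -(c₀ - 2 * Kb) * ∑ i, ‖Y t i - Z t i‖ ^ 2 := by
    intro t
    have hn0 : (0:ℝ) < n := by exact_mod_cast hn
    set a : Fin n → ℝ := fun i => ‖Y t i - Z t i‖ with ha
    have hterm : ∀ i, ⟪Y t i - Z t i, F Y i t - F Z i t⟫ ≤
        -c₀ * a i ^ 2 + (n:ℝ)⁻¹ * ∑ j, Kb * (3 / 2 * a i ^ 2 + 1 / 2 * a j ^ 2) := by
      intro i
      have e : F Y i t - F Z i t = (f (Y t i) - f (Z t i)) +
          (n:ℝ)⁻¹ • ∑ j, z i j • (b (Y t i) (Y t j) - b (Z t i) (Z t j)) := by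
        simp only [F, smul_sub, Finset.sum_sub_distrib]
        abel
      rw [e, inner_add_right, inner_smul_right, inner_sum]
      refine add_le_add (hdiss _ _) (mul_le_mul_of_nonneg_left ?_ (by positivity))
      refine Finset.sum_le_sum (fun j _ => ?_)
      rw [inner_smul_right]
      have h1 := real_inner_le_norm (Y t i - Z t i) (b (Y t i) (Y t j) - b (Z t i) (Z t j))
      have h2 := hb (Y t i) (Z t i) (Y t j) (Z t j)
      have h3 : ⟪Y t i - Z t i, b (Y t i) (Y t j) - b (Z t i) (Z t j)⟫
          ≤ a i * (Kb * (a i + a j)) :=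
        h1.trans (mul_le_mul_of_nonneg_left h2 (norm_nonneg _))
      have hi : 0 ≤ a i := norm_nonneg _
      have hj : 0 ≤ a j := norm_nonneg _
      have h4 : 0 ≤ a i * (Kb * (a i + a j)) := by positivity
      obtain ⟨z0, z1⟩ := hz i j
      have h5 := mul_le_mul_of_nonneg_left h3 z0
      have h6 := mul_le_of_le_one_left h4 z1
      have h7 := mul_nonneg hKb (sq_nonneg (a i - a j))
      linarith
    refine (Finset.sum_le_sum (fun i _ => hterm i)).trans (le_of_eq ?_)
    simp only [Finset.sum_add_distrib, ← Finset.mul_sum, Finset.sum_const, Finset.card_univ,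
      Fintype.card_fin, nsmul_eq_mul]
    field_simp
    ring
  have hSc : ContinuousOn (fun t => ∑ i, ‖Y t i - Z t i‖ ^ 2) (Set.Ici 0) :=
    continuousOn_finsetSum _ (fun i _ => (((hYc i).sub (hZc i)).norm).pow 2)
  have hanti : AntitoneOn (fun t => Real.exp (2 * (c₀ - 2 * Kb) * t) *
      ∑ i, ‖Y t i - Z t i‖ ^ 2) (Set.Ici 0) := by
    have hder : ∀ t : ℝ, 0 < t → HasDerivAt (fun t => Real.exp (2 * (c₀ - 2 * Kb) * t) *
        ∑ i, ‖Y t i - Z t i‖ ^ 2)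
        (Real.exp (2 * (c₀ - 2 * Kb) * t) * (2 * (c₀ - 2 * Kb)) * ∑ i, ‖Y t i - Z t i‖ ^ 2 +
          Real.exp (2 * (c₀ - 2 * Kb) * t) *
            ∑ i, 2 * ⟪Y t i - Z t i, F Y i t - F Z i t⟫) t := by
      intro t ht
      have h1 : HasDerivAt (fun t : ℝ => Real.exp (2 * (c₀ - 2 * Kb) * t))
          (Real.exp (2 * (c₀ - 2 * Kb) * t) * (2 * (c₀ - 2 * Kb))) t := by
        simpa using ((hasDerivAt_id t).const_mul (2 * (c₀ - 2 * Kb))).exp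
      exact h1.mul (HasDerivAt.fun_sum (fun i _ => (hD i t ht).norm_sq))
    refine antitoneOn_of_hasDerivWithinAt_nonpos (convex_Ici 0)
      (ContinuousOn.mul (by fun_prop) hSc)
      (fun t ht => (hder t (by simpa using ht)).hasDerivWithinAt) (fun t ht => ?_)
    rw [← Finset.mul_sum]
    have h := mul_le_mul_of_nonneg_left (key t) (Real.exp_pos (2 * (c₀ - 2 * Kb) * t)).le
    linarith
  intro t ht
  have h := hanti (Set.mem_Ici.2 le_rfl) (Set.mem_Ici.2 ht) ht
  simp only [mul_zero, Real.exp_zero, one_mul] at h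
  have h2 := mul_le_mul_of_nonneg_left h (Real.exp_pos (-2 * (c₀ - 2 * Kb) * t)).le
  rw [← mul_assoc, ← Real.exp_add] at h2
  have e : -2 * (c₀ - 2 * Kb) * t + 2 * (c₀ - 2 * Kb) * t = 0 := by ring
  rw [e, Real.exp_zero, one_mul] at h2
  exact h2
end
end

section
/- Let G be a graphon and let c₂, c₄, c₅, σ ∈ ℝ with c₂ > 0 and c₂ − 2·max{|c₄|, |c₅|} > 0. Suppose m, M : [0,1] → ℝ are bounded measurable functions satisfying, for every u ∈ [0,1], −c₂ m(u) + ∫₀¹ ( c₄ m(u) + c₅ m(v) ) G(u,v) dv = 0 and −c₂ M(u) + ∫₀¹ ( c₄ M(u) + c₅ m(u) m(v) ) G(u,v) dv + σ²/2 = 0. Then m(u) = 0 for every u ∈ [0,1], the quantity c₂ − c₄ ∫₀¹ G(u,v) dv is strictly positive for every u, and M(u) = σ² / ( 2( c₂ − c₄ ∫₀¹ G(u,v) dv ) ) for every u ∈ [0,1]. -/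
open MeasureTheory

noncomputable section

/-- A graphon: symmetric, measurable, `[0,1]`-valued. -/
def IsGraphon (G : ℝ → ℝ → ℝ) : Prop :=
  Measurable (Function.uncurry G) ∧ (∀ u v, G u v = G v u) ∧
    ∀ u v, G u v ∈ Set.Icc (0:ℝ) 1

/-- For the linear Gaussian example with `c₁ = c₃ = 0`: any bounded
measurable solutions `m, M` of the stationary moment equations satisfy `m ≡ 0`,
`c₂ − c₄ ∫ G(u,v) dv > 0`, and `M(u) = σ²/(2(c₂ − c₄ ∫₀¹ G(u,v) dv))`. -/
theorem stmt19 (G : ℝ → ℝ → ℝ) (hG : IsGraphon G)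
    (c₂ c₄ c₅ σ : ℝ) (hc₂ : 0 < c₂) (hdiss : 0 < c₂ - 2 * max |c₄| |c₅|)
    (m M : ℝ → ℝ) (hm : Measurable m) (hM : Measurable M)
    (hmb : ∃ K : ℝ, ∀ u ∈ Set.Icc (0:ℝ) 1, |m u| ≤ K)
    (hMb : ∃ K : ℝ, ∀ u ∈ Set.Icc (0:ℝ) 1, |M u| ≤ K)
    (heq1 : ∀ u ∈ Set.Icc (0:ℝ) 1,
      -c₂ * m u + (∫ v in Set.Icc (0:ℝ) 1, (c₄ * m u + c₅ * m v) * G u v) = 0)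
    (heq2 : ∀ u ∈ Set.Icc (0:ℝ) 1,
      -c₂ * M u + (∫ v in Set.Icc (0:ℝ) 1, (c₄ * M u + c₅ * m u * m v) * G u v)
        + σ ^ 2 / 2 = 0) :
    ∀ u ∈ Set.Icc (0:ℝ) 1,
      m u = 0 ∧
      0 < c₂ - c₄ * ∫ v in Set.Icc (0:ℝ) 1, G u v ∧
      M u = σ ^ 2 / (2 * (c₂ - c₄ * ∫ v in Set.Icc (0:ℝ) 1, G u v)) := by
  obtain ⟨K, hK⟩ := hmb
  set D := max |c₄| |c₅| with hD
  have h4 : |c₄| ≤ D := le_max_left _ _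
  have h5 : |c₅| ≤ D := le_max_right _ _
  have hD0 : 0 ≤ D := (abs_nonneg _).trans h4
  have hvol : (volume : Measure ℝ).real (Set.Icc (0:ℝ) 1) = 1 := by simp
  have hfin : (volume : Measure ℝ) (Set.Icc (0:ℝ) 1) < ⊤ := by simp
  have step : ∀ S : ℝ, (∀ u ∈ Set.Icc (0:ℝ) 1, |m u| ≤ S) →
      ∀ u ∈ Set.Icc (0:ℝ) 1, c₂ * |m u| ≤ 2 * D * S := by
    intro S hS u hu
    have hS0 : 0 ≤ S := (abs_nonneg _).trans (hS u hu)
    have hb : ‖∫ v in Set.Icc (0:ℝ) 1, (c₄ * m u + c₅ * m v) * G u v‖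
        ≤ (2 * D * S) * (volume : Measure ℝ).real (Set.Icc (0:ℝ) 1) := by
      apply norm_setIntegral_le_of_norm_le_const hfin
      intro v hv
      rw [Real.norm_eq_abs, abs_mul]
      have hg := hG.2.2 u v
      have hg1 : |G u v| ≤ 1 := by rw [abs_of_nonneg hg.1]; exact hg.2
      have ha : |c₄ * m u + c₅ * m v| ≤ 2 * D * S := by
        have e1 : |c₄ * m u| ≤ D * S := by
          rw [abs_mul]; exact mul_le_mul h4 (hS u hu) (abs_nonneg _) hD0
        have e2 : |c₅ * m v| ≤ D * S := by
          rw [abs_mul]; exact mul_le_mul h5 (hS v hv) (abs_nonneg _) hD0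
        have := abs_add_le (c₄ * m u) (c₅ * m v)
        linarith
      calc _ ≤ (2 * D * S) * 1 := mul_le_mul ha hg1 (abs_nonneg _) (by positivity)
        _ = _ := mul_one _
    rw [hvol, mul_one, Real.norm_eq_abs] at hb
    have e : (∫ v in Set.Icc (0:ℝ) 1, (c₄ * m u + c₅ * m v) * G u v) = c₂ * m u := by
      linarith [heq1 u hu]
    rw [e, abs_mul, abs_of_pos hc₂] at hb
    exact hb
  have hm0 : ∀ u ∈ Set.Icc (0:ℝ) 1, m u = 0 := by
    set S := sSup ((fun u => |m u|) '' Set.Icc (0:ℝ) 1) with hSdef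
    have hbdd : BddAbove ((fun u => |m u|) '' Set.Icc (0:ℝ) 1) := by
      refine ⟨K, ?_⟩
      rintro _ ⟨u, hu, rfl⟩
      exact hK u hu
    have hS : ∀ u ∈ Set.Icc (0:ℝ) 1, |m u| ≤ S := fun u hu =>
      le_csSup hbdd ⟨u, hu, rfl⟩
    have hle : S ≤ 2 * D * S / c₂ := by
      apply csSup_le
      · exact ⟨_, 0, by simp, rfl⟩
      · rintro _ ⟨u, hu, rfl⟩
        rw [le_div_iff₀ hc₂]
        linarith [step S hS u hu]
    rw [le_div_iff₀ hc₂] at hle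
    have hS0 : S ≤ 0 := by
      by_contra h
      push Not at h
      nlinarith [mul_pos hdiss h]
    intro u hu
    exact abs_nonpos_iff.mp ((hS u hu).trans hS0)
  intro u hu
  have hint : ‖∫ v in Set.Icc (0:ℝ) 1, G u v‖
      ≤ 1 * (volume : Measure ℝ).real (Set.Icc (0:ℝ) 1) := by
    apply norm_setIntegral_le_of_norm_le_const hfin
    intro v hv
    have hg := hG.2.2 u v
    rw [Real.norm_eq_abs, abs_of_nonneg hg.1]; exact hg.2
  rw [hvol, mul_one, Real.norm_eq_abs] at hint
  have h2 := heq2 u hu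
  simp only [hm0 u hu, mul_zero, zero_mul, add_zero, integral_const_mul] at h2
  generalize (∫ v in Set.Icc (0:ℝ) 1, G u v) = I at *
  have hpos : 0 < c₂ - c₄ * I := by
    have : |c₄ * I| ≤ D * 1 := by
      rw [abs_mul]; exact mul_le_mul h4 hint (abs_nonneg _) hD0
    have := le_abs_self (c₄ * I)
    linarith
  refine ⟨hm0 u hu, hpos, ?_⟩
  rw [eq_div_iff (by positivity)]
  linarith
end
end
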